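/- Smallness of the projection of higher-order random features onto a generic direction (content of Lemma B.12). Fix an integer k ≥ 3 and constants c, C₀ > 0. Let β ∈ ℝ^{B_{d,k}} satisfy ‖β‖₂ = 1 and ‖ι(β) ⊗_r ι(β)‖_F ≤ d^{−c} for every 1 ≤ r ≤ k−1, and let w₁,…,w_p be i.i.d. uniform on the unit sphere S^{d−1} with 1 ≤ p ≤ C₀d². Then there exists a constant c' > 0 depending only on k and c such that for every constant C > 0 there exist K', d₀ > 0 (depending only on k, c, C₀, C) with the following property: for all d ≥ d₀, with probability at least 1 − d^{−C}, ‖V_k β‖₂ ≤ (log d)^{K'}·d^{−c'}; in particular, for every K > 0, sup over θ ∈ ℝ^p with ‖θ‖₂ ≤ (log d)^K of |θᵀV_kβ| is at most (log d)^{K+K'}·d^{−c'} on the same event. -/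

import Mathlib

/-!
Smallness of the projection of higher-order random features onto a generic direction
(content of Lemma B.12).
-/

noncomputable section

open MeasureTheory ProbabilityTheory

/-- Multi-indices on `Fin d` of total degree `k`. -/
abbrev MIdx (d k : ℕ) : Type :=
  {κ : Fin d → ℕ // κ ∈ Finset.Nat.antidiagonalTuple d k}

/-- Euclidean dot product on `ι → ℝ`. -/
def dotp {ι : Type*} [Fintype ι] (u v : ι → ℝ) : ℝ := ∑ i, u i * v i

/-- Euclidean norm on `ι → ℝ`. -/
def enorm2 {ι : Type*} [Fintype ι] (u : ι → ℝ) : ℝ := Real.sqrt (∑ i, (u i) ^ 2)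

/-- The standard Gaussian measure on `ι → ℝ`. -/
def stdG (ι : Type*) [Fintype ι] : Measure (ι → ℝ) :=
  Measure.pi fun _ => gaussianReal 0 1

/-- The uniform distribution on the unit sphere of `ι → ℝ`. -/
def unifSphere (ι : Type*) [Fintype ι] : Measure (ι → ℝ) :=
  (stdG ι).map fun x => (enorm2 x)⁻¹ • x

/-- The vector `q_k(w)`. -/
def qvec (d k : ℕ) (w : Fin d → ℝ) : MIdx d k → ℝ :=
  fun κ => Real.sqrt ((Nat.factorial k : ℝ) / ∏ i, (Nat.factorial (κ.1 i) : ℝ)) *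
    ∏ i, (w i) ^ (κ.1 i)

/-- `typeOf i` records how many times each value of `Fin d` occurs in the tuple `i`. -/
def typeOf {k d : ℕ} (i : Fin k → Fin d) : Fin d → ℕ :=
  fun a => (Finset.univ.filter fun t => i t = a).card

/-- The isometric embedding `ι : ℝ^{B_{d,k}} → (ℝ^d)^{⊗k}` into symmetric `k`-tensors. -/
def iotaT (d k : ℕ) (v : MIdx d k → ℝ) : (Fin k → Fin d) → ℝ :=
  fun i =>
    if h : typeOf i ∈ Finset.Nat.antidiagonalTuple d k then
      Real.sqrt ((∏ a, (Nat.factorial (typeOf i a) : ℝ)) / (Nat.factorial k : ℝ)) *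
        v ⟨typeOf i, h⟩
    else 0

/-- Combine a tuple of `k - r` free indices with a tuple of `r` contracted indices. -/
def splitIdx (d k r : ℕ) (i : Fin (k - r) → Fin d) (a : Fin r → Fin d) : Fin k → Fin d :=
  fun t => if h : (t : ℕ) < k - r then i ⟨t, h⟩ else a ⟨(t : ℕ) - (k - r), by omega⟩

/-- The squared Frobenius norm `‖S ⊗_r T‖_F²` of the contraction over `r` indices. -/
def contrNormSq (d k r : ℕ) (S T : (Fin k → Fin d) → ℝ) : ℝ :=
  ∑ ij : (Fin (k - r) → Fin d) × (Fin (k - r) → Fin d),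
    (∑ a : Fin r → Fin d, S (splitIdx d k r ij.1 a) * T (splitIdx d k r ij.2 a)) ^ 2

section GaussPart
open MvPolynomial

instance stdG_prob (d : ℕ) : IsProbabilityMeasure (stdG (Fin d)) := by
  unfold stdG; infer_instance

lemma gauss_integrable_pow (n : ℕ) :
    Integrable (fun x : ℝ => x ^ n) (gaussianReal 0 1) := by
  have h := (memLp_id_gaussianReal (μ := 0) (v := 1) (n : NNReal)).integrable_norm_pow'
  have h2 : Integrable (fun x : ℝ => ‖x ^ n‖) (gaussianReal 0 1) := by
    simpa using h
  exact (integrable_norm_iff (by fun_prop)).1 h2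

lemma gauss_integrable_pdf (n : ℕ) :
    Integrable (fun x : ℝ => x ^ n * gaussianPDFReal 0 1 x) := by
  have h := gauss_integrable_pow n
  rw [gaussianReal_of_var_ne_zero _ one_ne_zero,
    integrable_withDensity_iff_integrable_smul₀' (by fun_prop)
      (ae_of_all _ fun _ => gaussianPDF_lt_top)] at h
  simpa [mul_comm] using h

lemma gauss_deriv_pdf (x : ℝ) :
    HasDerivAt (fun x => - gaussianPDFReal 0 1 x) (x * gaussianPDFReal 0 1 x) x := by
  unfold gaussianPDFReal
  have h : HasDerivAt (fun x : ℝ => -(x - 0) ^ 2 / (2 * ((1 : NNReal) : ℝ))) (-x) x := by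
    have := ((hasDerivAt_id x).sub_const 0).pow 2 |>.neg.div_const (2 * ((1 : NNReal) : ℝ))
    refine this.congr_deriv ?_
    simp only [id, NNReal.coe_one]
    norm_num
    ring
  have := (h.exp.const_mul ((√(2 * Real.pi * ((1 : NNReal) : ℝ)))⁻¹)).neg
  refine this.congr_deriv ?_
  ring

lemma gauss_stein1 (n : ℕ) :
    ∫ x, x ^ (n + 1) ∂(gaussianReal 0 1) = n * ∫ x, x ^ (n - 1) ∂(gaussianReal 0 1) := by
  rw [integral_gaussianReal_eq_integral_smul one_ne_zero,
    integral_gaussianReal_eq_integral_smul one_ne_zero]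
  have h := integral_mul_deriv_eq_deriv_mul_of_integrable
    (u := fun x : ℝ => x ^ n) (u' := fun x => n * x ^ (n - 1))
    (v := fun x => - gaussianPDFReal 0 1 x) (v' := fun x => x * gaussianPDFReal 0 1 x)
    (fun x _ => hasDerivAt_pow n x) (fun x _ => gauss_deriv_pdf x)
    (by
      refine (gauss_integrable_pdf (n + 1)).congr (ae_of_all _ fun x => ?_)
      simp; ring)
    (by
      refine ((gauss_integrable_pdf (n - 1)).const_mul (-(n : ℝ))).congr
        (ae_of_all _ fun x => ?_)
      simp; ring)
    (by
      refine ((gauss_integrable_pdf n).const_mul (-1)).congr (ae_of_all _ fun x => ?_)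
      simp)
  rw [← integral_const_mul]
  rw [← integral_neg] at h
  refine Eq.trans ?_ (h.trans ?_)
  · congr 1; funext x; simp only [smul_eq_mul]; ring
  · congr 1; funext x; simp only [smul_eq_mul]; ring

lemma poly_integrable {d : ℕ} (p : MvPolynomial (Fin d) ℝ) :
    Integrable (fun x => eval x p) (stdG (Fin d)) := by
  induction p using MvPolynomial.induction_on' with
  | add p q hp hq => 
    refine (hp.add hq).congr (ae_of_all _ fun x => ?_)
    simp
  | monomial s a =>
    simp only [eval_monomial, Finsupp.prod_fintype _ _ (fun _ => pow_zero _)]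
    exact (Integrable.fintype_prod (f := fun i (y : ℝ) => y ^ s i)
      (fun i => gauss_integrable_pow (s i))).const_mul a

lemma poly_stein {d : ℕ} (i : Fin d) (p : MvPolynomial (Fin d) ℝ) :
    ∫ x, x i * eval x p ∂(stdG (Fin d)) = ∫ x, eval x (pderiv i p) ∂(stdG (Fin d)) := by
  induction p using MvPolynomial.induction_on' with
  | add p q hp hq =>
    have e : ∀ q : MvPolynomial (Fin d) ℝ,
        Integrable (fun x => x i * eval x q) (stdG (Fin d)) := fun q => by
      
      refine (poly_integrable (X i * q)).congr (ae_of_all _ fun x => ?_)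
      simp
    simp only [map_add, mul_add]
    rw [integral_add (e p) (e q), integral_add (poly_integrable _) (poly_integrable _), hp, hq]
  | monomial s a =>
    simp only [pderiv_monomial, eval_monomial, Finsupp.prod_fintype _ _ (fun _ => pow_zero _)]
    have h1 : ∀ x : Fin d → ℝ, x i * (a * ∏ j, x j ^ s j)
        = a * ∏ j, x j ^ (s j + if j = i then 1 else 0) := by
      intro x
      have : ∏ j, x j ^ (if j = i then 1 else 0) = x i := by
        rw [Finset.prod_eq_single i] <;> simp +contextual
      simp only [pow_add, Finset.prod_mul_distrib, this]
      ring
    simp only [h1, integral_const_mul, stdG]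
    rw [integral_fintype_prod_eq_prod (f := fun j (y : ℝ) => y ^ (s j + if j = i then 1 else 0)),
      integral_fintype_prod_eq_prod (f := fun j (y : ℝ) => y ^ ((s - Finsupp.single i 1 : Fin d →₀ ℕ) j)),
      ← Finset.mul_prod_erase _ _ (Finset.mem_univ i),
      ← Finset.mul_prod_erase _ (fun j => ∫ y : ℝ, y ^ ((s - Finsupp.single i 1 : Fin d →₀ ℕ) j) ∂(gaussianReal 0 1))
        (Finset.mem_univ i)]
    simp only [if_true, gauss_stein1]
    have h2 : ∏ j ∈ Finset.univ.erase i, ∫ y : ℝ, y ^ (s j + if j = i then 1 else 0)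
          ∂(gaussianReal 0 1)
        = ∏ j ∈ Finset.univ.erase i, ∫ y : ℝ, y ^ ((s - Finsupp.single i 1 : Fin d →₀ ℕ) j)
          ∂(gaussianReal 0 1) := by
      refine Finset.prod_congr rfl fun j hj => ?_
      have : j ≠ i := Finset.ne_of_mem_erase hj
      simp [this]
    rw [h2]
    simp
    ring

end GaussPart
section MomentPart
open MvPolynomial

/-- The Laplacian of a polynomial. -/
def lapP {d : ℕ} (p : MvPolynomial (Fin d) ℝ) : MvPolynomial (Fin d) ℝ :=
  ∑ i, pderiv i (pderiv i p)

/-- Sum of the squares of the constant terms of all `s`-th order partial derivatives. -/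
def derivSq {d : ℕ} : ℕ → MvPolynomial (Fin d) ℝ → ℝ
  | 0, p => (coeff 0 p) ^ 2
  | s + 1, p => ∑ i, derivSq s (pderiv i p)

lemma pderiv_comm' {d : ℕ} (i j : Fin d) (p : MvPolynomial (Fin d) ℝ) :
    pderiv i (pderiv j p) = pderiv j (pderiv i p) := by
  ext m
  simp only [coeff_pderiv]
  rw [add_right_comm]
  by_cases h : i = j
  · subst h; rfl
  · simp [h, Ne.symm h]
    ring

lemma lapP_pderiv {d : ℕ} (i : Fin d) (p : MvPolynomial (Fin d) ℝ) :
    lapP (pderiv i p) = pderiv i (lapP p) := by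
  simp only [lapP, map_sum]
  refine Finset.sum_congr rfl fun j _ => ?_
  rw [pderiv_comm' j i p, pderiv_comm' j i]

lemma lapP_iter_pderiv {d : ℕ} (i : Fin d) (j : ℕ) (p : MvPolynomial (Fin d) ℝ) :
    lapP^[j] (pderiv i p) = pderiv i (lapP^[j] p) := by
  induction j generalizing p with
  | zero => rfl
  | succ j ih => rw [Function.iterate_succ_apply, Function.iterate_succ_apply, lapP_pderiv, ih]

lemma lapP_hom {d k : ℕ} {p : MvPolynomial (Fin d) ℝ} (h : p.IsHomogeneous (k + 2)) :
    (lapP p).IsHomogeneous k :=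
  IsHomogeneous.sum _ _ _ fun i _ => by simpa using h.pderiv.pderiv

lemma lapP_hom_one {d : ℕ} {p : MvPolynomial (Fin d) ℝ} (h : p.IsHomogeneous 1) :
    lapP p = 0 := by
  refine Finset.sum_eq_zero fun i _ => ?_
  have h1 : (pderiv i p).IsHomogeneous 0 := h.pderiv
  rw [← totalDegree_zero_iff_isHomogeneous, totalDegree_eq_zero_iff_eq_C] at h1
  rw [h1, pderiv_C]

lemma young_pow (n : ℕ) {a u : ℝ} (ha : 0 ≤ a) (hu : 0 ≤ u) :
    a * u ^ n ≤ u ^ (n + 1) / 2 + 2 ^ n * a ^ (n + 1) := by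
  rcases le_total (2 * a) u with h | h
  · have h1 : a * u ^ n ≤ u / 2 * u ^ n := by gcongr; linarith
    have h2 : 0 ≤ 2 ^ n * a ^ (n + 1) := by positivity
    rw [pow_succ]; linarith
  · have h1 : a * u ^ n ≤ a * (2 * a) ^ n := by gcongr
    have h2 : 0 ≤ u ^ (n + 1) / 2 := by positivity
    rw [mul_pow] at h1
    rw [pow_succ a]; linarith

lemma pointwise_bound {ι κ : Type} [Fintype ι] [Fintype κ] (n : ℕ) (a l : ι → ℝ)
    (g : ι → κ → ℝ) :
    (∑ α, ∑ i, g α i ^ 2 + ∑ α, a α * l α) * (∑ α, a α ^ 2) ^ n +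
      ∑ i, (∑ α, a α * g α i) * (n * (∑ α, a α ^ 2) ^ (n - 1) * (2 * ∑ α, a α * g α i))
    ≤ 3 / 4 * (∑ α, a α ^ 2) ^ (n + 1) +
      2 ^ n / 2 * (∑ α, l α ^ 2 + 2 * (1 + 2 * n) * ∑ α, ∑ i, g α i ^ 2) ^ (n + 1) := by
  set u := ∑ α, a α ^ 2 with hu
  set v := ∑ α, l α ^ 2 with hv
  set w := ∑ α, ∑ i, g α i ^ 2 with hw
  have hu0 : 0 ≤ u := by positivity
  have hv0 : 0 ≤ v := by positivity
  have hw0 : 0 ≤ w := by positivity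
  have h1 : ∑ α, a α * l α ≤ (u + v) / 2 := by
    rw [hu, hv, ← Finset.sum_add_distrib, Finset.sum_div]
    refine Finset.sum_le_sum fun α _ => ?_
    nlinarith [sq_nonneg (a α - l α)]
  have h2 : ∑ i, (∑ α, a α * g α i) ^ 2 ≤ u * w := by
    rw [hw, Finset.sum_comm, Finset.mul_sum]
    exact Finset.sum_le_sum fun i _ => Finset.sum_mul_sq_le_sq_mul_sq _ _ _
  have h3 : ∑ i, (∑ α, a α * g α i) * (n * u ^ (n - 1) * (2 * ∑ α, a α * g α i))
      ≤ 2 * n * w * u ^ n := by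
    have e : ∑ i, (∑ α, a α * g α i) * (n * u ^ (n - 1) * (2 * ∑ α, a α * g α i))
        = 2 * n * u ^ (n - 1) * ∑ i, (∑ α, a α * g α i) ^ 2 := by
      rw [Finset.mul_sum]
      exact Finset.sum_congr rfl fun i _ => by ring
    rw [e]
    calc 2 * n * u ^ (n - 1) * ∑ i, (∑ α, a α * g α i) ^ 2
        ≤ 2 * n * u ^ (n - 1) * (u * w) := by gcongr
      _ = 2 * n * w * u ^ n := by
        rcases n with _ | n
        · simp
        · simp only [Nat.add_sub_cancel, pow_succ]; ring
  have h4 := young_pow n (a := v + 2 * (1 + 2 * n) * w) (u := u) (by positivity) hu0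
  have h5 : (w + ∑ α, a α * l α) * u ^ n ≤ (w + (u + v) / 2) * u ^ n := by gcongr
  have h6 : u ^ (n + 1) = u * u ^ n := by ring
  nlinarith

/-- Gaussian expectation of a polynomial. -/
def gE {d : ℕ} (p : MvPolynomial (Fin d) ℝ) : ℝ := ∫ x, eval x p ∂(stdG (Fin d))

lemma gE_add {d : ℕ} (p q : MvPolynomial (Fin d) ℝ) : gE (p + q) = gE p + gE q := by
  simp only [gE, map_add]
  exact integral_add (poly_integrable _) (poly_integrable _)

lemma gE_C_mul {d : ℕ} (a : ℝ) (p : MvPolynomial (Fin d) ℝ) : gE (C a * p) = a * gE p := by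
  simp only [gE, map_mul, eval_C, integral_const_mul]

lemma gE_sum {d : ℕ} {ι : Type*} (s : Finset ι) (p : ι → MvPolynomial (Fin d) ℝ) :
    gE (∑ i ∈ s, p i) = ∑ i ∈ s, gE (p i) := by
  simp only [gE, map_sum]
  exact integral_finsetSum _ fun i _ => poly_integrable _

lemma gE_mono {d : ℕ} {p q : MvPolynomial (Fin d) ℝ} (h : ∀ x, eval x p ≤ eval x q) :
    gE p ≤ gE q :=
  integral_mono (poly_integrable _) (poly_integrable _) h

lemma gE_stein {d : ℕ} (i : Fin d) (p : MvPolynomial (Fin d) ℝ) :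
    gE (X i * p) = gE (pderiv i p) := by
  simpa [gE] using poly_stein i p

lemma moment_step {d k : ℕ} {ι : Type} [Fintype ι] (n : ℕ) (F : ι → MvPolynomial (Fin d) ℝ)
    (hF : ∀ α, (F α).IsHomogeneous (k + 1)) :
    gE ((∑ α, F α ^ 2) ^ (n + 1)) ≤ 2 ^ (n + 1) *
      gE ((∑ α, lapP (F α) ^ 2 +
        C (2 * (1 + 2 * (n : ℝ))) * ∑ α, ∑ i, pderiv i (F α) ^ 2) ^ (n + 1)) := by
  set u := ∑ α, F α ^ 2 with hu
  set A := ∑ α, lapP (F α) ^ 2 + C (2 * (1 + 2 * (n : ℝ))) * ∑ α, ∑ i, pderiv i (F α) ^ 2 with hA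
  have e1 : ((k + 1 : ℕ) : ℝ) * gE (u ^ (n + 1))
      = gE (∑ i, pderiv i ((∑ α, F α * pderiv i (F α)) * u ^ n)) := by
    rw [gE_sum, ← gE_C_mul]
    simp only [← gE_stein]
    rw [← gE_sum]
    congr 1
    have h1 : ∀ i : Fin d, X i * ((∑ α, F α * pderiv i (F α)) * u ^ n)
        = (∑ α, F α * (X i * pderiv i (F α))) * u ^ n := by
      intro i
      rw [← mul_assoc, Finset.mul_sum]
      congr 1
      exact Finset.sum_congr rfl fun α _ => by ring
    simp only [h1]
    rw [← Finset.sum_mul, Finset.sum_comm]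
    simp only [← Finset.mul_sum, (hF _).sum_X_mul_pderiv]
    rw [pow_succ', ← mul_assoc]
    congr 1
    rw [hu, Finset.mul_sum]
    refine Finset.sum_congr rfl fun α _ => ?_
    simp only [nsmul_eq_mul, map_natCast]
    ring
  have e2 : gE (∑ i, pderiv i ((∑ α, F α * pderiv i (F α)) * u ^ n))
      ≤ gE (C (3 / 4) * u ^ (n + 1) + C (2 ^ n / 2) * A ^ (n + 1)) := by
    refine gE_mono fun x => ?_
    have h := pointwise_bound n (fun α => eval x (F α)) (fun α => eval x (lapP (F α)))
      (fun α i => eval x (pderiv i (F α)))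
    have r : eval x (C (3 / 4) * u ^ (n + 1) + C (2 ^ n / 2) * A ^ (n + 1))
        = 3 / 4 * (∑ α, eval x (F α) ^ 2) ^ (n + 1) +
      2 ^ n / 2 * (∑ α, eval x (lapP (F α)) ^ 2 +
        2 * (1 + 2 * n) * ∑ α, ∑ i, eval x (pderiv i (F α)) ^ 2) ^ (n + 1) := by
      simp [hu, hA]
    rw [r]
    refine le_trans (le_of_eq ?_) h
    have e3 : ∀ i, pderiv i ((∑ α, F α * pderiv i (F α)) * u ^ n)
        = (∑ α, pderiv i (F α) ^ 2 + ∑ α, F α * pderiv i (pderiv i (F α))) * u ^ n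
          + (∑ α, F α * pderiv i (F α)) *
            (n * u ^ (n - 1) * (2 * ∑ α, F α * pderiv i (F α))) := by
      intro i
      rw [pderiv_mul, pderiv_pow]
      have a1 : pderiv i (∑ α, F α * pderiv i (F α))
          = ∑ α, pderiv i (F α) ^ 2 + ∑ α, F α * pderiv i (pderiv i (F α)) := by
        rw [map_sum, ← Finset.sum_add_distrib]
        refine Finset.sum_congr rfl fun α _ => ?_
        rw [pderiv_mul]; ring
      have a2 : pderiv i u = 2 * ∑ α, F α * pderiv i (F α) := by
        rw [hu, map_sum, Finset.mul_sum]
        refine Finset.sum_congr rfl fun α _ => ?_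
        rw [pderiv_pow]; push_cast; ring
      rw [a1, a2]
    simp only [e3]
    rw [Finset.sum_add_distrib, ← Finset.sum_mul, Finset.sum_add_distrib, Finset.sum_comm,
      Finset.sum_comm (f := fun i α => F α * pderiv i (pderiv i (F α)))]
    simp only [← Finset.mul_sum]
    have e4 : ∀ α, ∑ i, pderiv i (pderiv i (F α)) = lapP (F α) := fun α => rfl
    simp only [e4]
    simp [hu]
  rw [gE_add, gE_C_mul, gE_C_mul] at e2
  have p0 : 0 ≤ gE (u ^ (n + 1)) := by
    refine integral_nonneg fun x => ?_
    simp only [hu, map_pow, map_sum]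
    positivity
  have : gE (u ^ (n + 1)) ≤ ((k + 1 : ℕ) : ℝ) * gE (u ^ (n + 1)) := by
    push_cast
    nlinarith [(Nat.cast_nonneg k : (0 : ℝ) ≤ k)]
  rw [pow_succ (2 : ℝ)]
  linarith

theorem moment_bound (n k : ℕ) : ∃ K : ℝ, 0 ≤ K ∧ ∀ (d : ℕ) (ι : Type) [Fintype ι]
    (F : ι → MvPolynomial (Fin d) ℝ) (B : ℝ), (∀ α, (F α).IsHomogeneous k) →
    (∀ j s, 2 * j + s = k → ∑ α, derivSq s (lapP^[j] (F α)) ≤ B) →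
    gE ((∑ α, F α ^ 2) ^ (n + 1)) ≤ K * B ^ (n + 1) := by
  induction k using Nat.strong_induction_on with
  | _ k ih =>
  rcases k with _ | k
  · refine ⟨1, zero_le_one, fun d ι _ F B hF hB => ?_⟩
    have h := hB 0 0 rfl
    simp only [Function.iterate_zero, id, derivSq] at h
    have hc : ∀ α, F α = C (coeff 0 (F α)) := fun α => by
      have h1 := hF α
      rwa [← totalDegree_zero_iff_isHomogeneous, totalDegree_eq_zero_iff_eq_C] at h1
    have : gE ((∑ α, F α ^ 2) ^ (n + 1)) = (∑ α, (coeff 0 (F α)) ^ 2) ^ (n + 1) := by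
      have : ∀ x, eval x ((∑ α, F α ^ 2) ^ (n + 1)) = (∑ α, (coeff 0 (F α)) ^ 2) ^ (n + 1) := by
        intro x
        rw [Finset.sum_congr rfl fun α _ => congrArg (· ^ 2) (hc α)]
        simp
      simp only [gE, this]
      simp
    rw [this, one_mul]
    gcongr
  · obtain ⟨K1, hK1, ih1⟩ := ih k (Nat.lt_succ_self k)
    have ih2 : ∃ K : ℝ, 0 ≤ K ∧ ∀ (d : ℕ) (ι : Type) [Fintype ι]
        (F : ι → MvPolynomial (Fin d) ℝ) (B : ℝ), 0 ≤ B → (∀ α, (F α).IsHomogeneous (k + 1)) →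
        (∀ j s, 2 * j + s = k + 1 → ∑ α, derivSq s (lapP^[j] (F α)) ≤ B) →
        gE ((∑ α, lapP (F α) ^ 2) ^ (n + 1)) ≤ K * B ^ (n + 1) := by
      rcases k with _ | k
      · refine ⟨0, le_rfl, fun d ι _ F B _ hF hB => ?_⟩
        have : ∀ α, lapP (F α) = 0 := fun α => lapP_hom_one (hF α)
        simp [this, gE]
      · obtain ⟨K, hK, h⟩ := ih k (by omega)
        refine ⟨K, hK, fun d ι _ F B _ hF hB => h d ι (fun α => lapP (F α)) B
          (fun α => lapP_hom (hF α)) fun j s hjs => ?_⟩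
        have := hB (j + 1) s (by omega)
        simpa only [Function.iterate_succ_apply] using this
    obtain ⟨K2, hK2, ih2⟩ := ih2
    refine ⟨2 ^ (n + 1) * (2 ^ n * (K2 + (2 * (1 + 2 * n)) ^ (n + 1) * K1)), by positivity,
      fun d ι _ F B hF hB => ?_⟩
    have hB0 : 0 ≤ B := by
      refine le_trans ?_ (hB 0 (k + 1) (by simp))
      refine Finset.sum_nonneg fun α _ => ?_
      have : ∀ s (p : MvPolynomial (Fin d) ℝ), 0 ≤ derivSq s p := by
        intro s
        induction s with
        | zero => intro p; exact sq_nonneg _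
        | succ s ih => intro p; exact Finset.sum_nonneg fun i _ => ih _
      exact this _ _
    have s2 := ih2 d ι F B hB0 hF hB
    have s1 := ih1 d (ι × Fin d) (fun q => pderiv q.2 (F q.1)) B (fun q => (hF q.1).pderiv)
      (fun j s hjs => by
        have := hB j (s + 1) (by omega)
        rw [Fintype.sum_prod_type]
        simpa only [lapP_iter_pderiv, derivSq] using this)
    rw [Fintype.sum_prod_type] at s1
    refine (moment_step n F hF).trans ?_
    rw [mul_assoc]
    gcongr
    refine le_trans (gE_mono (q := C (2 ^ n) * ((∑ α, lapP (F α) ^ 2) ^ (n + 1) +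
      C ((2 * (1 + 2 * (n : ℝ))) ^ (n + 1)) * (∑ α, ∑ i, pderiv i (F α) ^ 2) ^ (n + 1)))
      fun x => ?_) ?_
    · simp only [map_pow, map_add, map_mul, map_sum, eval_C]
      rw [← mul_pow]
      exact add_pow_le (by positivity) (by positivity) (n + 1)
    · rw [gE_C_mul, gE_add, gE_C_mul, mul_assoc]
      have : (2 * (1 + 2 * (n : ℝ))) ^ (n + 1) *
          gE ((∑ α, ∑ i, pderiv i (F α) ^ 2) ^ (n + 1))
          ≤ (2 * (1 + 2 * (n : ℝ))) ^ (n + 1) * (K1 * B ^ (n + 1)) := by gcongr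
      have h2 : (0 : ℝ) < 2 ^ n := by positivity
      refine mul_le_mul_of_nonneg_left ?_ h2.le
      nlinarith

end MomentPart
section TensorPart
open MvPolynomial

/-- The homogeneous polynomial attached to `β`. -/
def polyB {d k : ℕ} (β : MIdx d k → ℝ) : MvPolynomial (Fin d) ℝ :=
  ∑ κ : MIdx d k, monomial (Finsupp.equivFunOnFinite.symm κ.1)
    (Real.sqrt ((Nat.factorial k : ℝ) / ∏ i, (Nat.factorial (κ.1 i) : ℝ)) * β κ)

lemma eval_polyB {d k : ℕ} (β : MIdx d k → ℝ) (x : Fin d → ℝ) :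
    eval x (polyB β) = dotp (qvec d k x) β := by
  simp only [polyB, map_sum, eval_monomial, dotp, qvec,
    Finsupp.prod_fintype _ _ (fun _ => pow_zero _)]
  refine Finset.sum_congr rfl fun κ _ => ?_
  simp only [Finsupp.equivFunOnFinite_symm_apply_apply]
  ring

lemma polyB_hom {d k : ℕ} (β : MIdx d k → ℝ) : (polyB β).IsHomogeneous k := by
  refine IsHomogeneous.sum _ _ _ fun κ _ => isHomogeneous_monomial _ ?_
  rw [Finsupp.degree_eq_sum]
  simpa using Finset.Nat.mem_antidiagonalTuple.1 κ.2

lemma coeff_polyB {d k : ℕ} (β : MIdx d k → ℝ) (κ : MIdx d k) :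
    coeff (Finsupp.equivFunOnFinite.symm κ.1) (polyB β) =
      Real.sqrt ((Nat.factorial k : ℝ) / ∏ i, (Nat.factorial (κ.1 i) : ℝ)) * β κ := by
  simp only [polyB, coeff_sum, coeff_monomial]
  rw [Finset.sum_eq_single κ]
  · simp
  · intro b _ hb
    rw [if_neg]
    intro h
    exact hb (Subtype.ext (Finsupp.equivFunOnFinite.symm.injective h))
  · simp

/-- Iterated partial derivatives along a list. -/
def Dl {d : ℕ} : List (Fin d) → MvPolynomial (Fin d) ℝ → MvPolynomial (Fin d) ℝ
  | [], p => p
  | i :: l, p => Dl l (pderiv i p)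

/-- Counting vector of a list. -/
def cntL {d : ℕ} : List (Fin d) → (Fin d →₀ ℕ)
  | [] => 0
  | i :: l => cntL l + Finsupp.single i 1

lemma Dl_coeff {d : ℕ} (l : List (Fin d)) (p : MvPolynomial (Fin d) ℝ) :
    coeff 0 (Dl l p) = coeff (cntL l) p * ∏ i, (Nat.factorial (cntL l i) : ℝ) := by
  induction l generalizing p with
  | nil => simp [Dl, cntL]
  | cons i l ih =>
    rw [Dl, ih, coeff_pderiv, cntL, mul_assoc]
    congr 1
    rw [← Finset.mul_prod_erase _ _ (Finset.mem_univ i),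
      ← Finset.mul_prod_erase _ (fun j => (Nat.factorial ((cntL l + Finsupp.single i 1 : Fin d →₀ ℕ) j) : ℝ))
        (Finset.mem_univ i), ← mul_assoc]
    congr 1
    · simp [Nat.factorial_succ]
    · refine Finset.prod_congr rfl fun j hj => ?_
      have : j ≠ i := Finset.ne_of_mem_erase hj
      simp [this]

lemma cntL_apply {d : ℕ} (l : List (Fin d)) (a : Fin d) : cntL l a = l.count a := by
  induction l with
  | nil => simp [cntL]
  | cons i l ih => simp [cntL, ih, List.count_cons, Finsupp.single_apply]

lemma cntL_ofFn {d n : ℕ} (i : Fin n → Fin d) :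
    cntL (List.ofFn i) = Finsupp.equivFunOnFinite.symm (typeOf i) := by
  ext a
  rw [Finsupp.equivFunOnFinite_symm_apply_apply]
  induction n with
  | zero => simp [cntL, typeOf]
  | succ n ih =>
    rw [List.ofFn_succ, cntL, Finsupp.add_apply, ih]
    simp only [typeOf, Finset.card_filter, Fin.sum_univ_succ, Finsupp.single_apply]
    rw [add_comm]

lemma typeOf_mem {d k : ℕ} (i : Fin k → Fin d) :
    typeOf i ∈ Finset.Nat.antidiagonalTuple d k := by
  rw [Finset.Nat.mem_antidiagonalTuple]
  simp only [typeOf]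
  rw [← Finset.card_eq_sum_card_fiberwise (fun _ _ => Finset.mem_univ _)]
  simp

lemma Dl_polyB {d k : ℕ} (β : MIdx d k → ℝ) (i : Fin k → Fin d) :
    coeff 0 (Dl (List.ofFn i) (polyB β)) = Nat.factorial k * iotaT d k β i := by
  rw [Dl_coeff, cntL_ofFn, coeff_polyB β ⟨typeOf i, typeOf_mem i⟩, iotaT, dif_pos (typeOf_mem i)]
  simp only [Finsupp.equivFunOnFinite_symm_apply_apply]
  have hP : (0 : ℝ) < ∏ a, (Nat.factorial (typeOf i a) : ℝ) :=
    Finset.prod_pos fun a _ => by positivity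
  set P := ∏ a, (Nat.factorial (typeOf i a) : ℝ)
  have hk : (0 : ℝ) < Nat.factorial k := by positivity
  set Q := (Nat.factorial k : ℝ)
  have h : Real.sqrt (Q / P) * P = Q * Real.sqrt (P / Q) := by
    rw [Real.sqrt_div hk.le, Real.sqrt_div hP.le]
    have h1 := Real.mul_self_sqrt hk.le
    have h2 := Real.mul_self_sqrt hP.le
    have h3 := (Real.sqrt_pos.2 hk).ne'
    have h4 := (Real.sqrt_pos.2 hP).ne'
    field_simp
    nlinarith
  rw [mul_right_comm, h]; ring

lemma Dl_sum {d : ℕ} {ι : Type*} (l : List (Fin d)) (s : Finset ι)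
    (p : ι → MvPolynomial (Fin d) ℝ) : Dl l (∑ a ∈ s, p a) = ∑ a ∈ s, Dl l (p a) := by
  induction l generalizing p with
  | nil => rfl
  | cons i l ih => simp only [Dl, map_sum, ih]

lemma lapP_iter_sum {d : ℕ} {ι : Type*} (j : ℕ) (s : Finset ι)
    (p : ι → MvPolynomial (Fin d) ℝ) : lapP^[j] (∑ a ∈ s, p a) = ∑ a ∈ s, lapP^[j] (p a) := by
  induction j generalizing p with
  | zero => rfl
  | succ j ih =>
    simp only [Function.iterate_succ_apply, ← ih]
    congr 1
    simp only [lapP, map_sum]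
    rw [Finset.sum_comm]

lemma sum_fin_cons {d s : ℕ} (f : (Fin (s + 1) → Fin d) → ℝ) :
    ∑ a, f a = ∑ i, ∑ a : Fin s → Fin d, f (Fin.cons i a) := by
  rw [← (Fin.consEquiv (fun _ => Fin d)).sum_comp, Fintype.sum_prod_type]
  rfl

lemma derivSq_eq {d : ℕ} (s : ℕ) (p : MvPolynomial (Fin d) ℝ) :
    derivSq s p = ∑ a : Fin s → Fin d, (coeff 0 (Dl (List.ofFn a) p)) ^ 2 := by
  induction s generalizing p with
  | zero => simp [derivSq, Dl]
  | succ s ih =>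
    rw [sum_fin_cons]
    simp only [derivSq, ih, List.ofFn_cons, Dl]

/-- Repeat every entry of a list twice. -/
def dupL {d : ℕ} : List (Fin d) → List (Fin d)
  | [] => []
  | i :: l => i :: i :: dupL l

lemma dupL_length {d : ℕ} (l : List (Fin d)) : (dupL l).length = 2 * l.length := by
  induction l with
  | nil => rfl
  | cons i l ih => simp [dupL, ih]; ring

lemma dupL_inj {d : ℕ} (l l' : List (Fin d)) (h : dupL l = dupL l') : l = l' := by
  induction l generalizing l' with
  | nil => cases l' <;> simp_all [dupL]
  | cons i l ih =>
    cases l' with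
    | nil => simp [dupL] at h
    | cons i' l' =>
      simp only [dupL, List.cons.injEq] at h
      rw [h.1, ih l' h.2.2]

lemma Dl_lapP {d : ℕ} (j : ℕ) (l : List (Fin d)) (p : MvPolynomial (Fin d) ℝ) :
    coeff 0 (Dl l (lapP^[j] p)) =
      ∑ b : Fin j → Fin d, coeff 0 (Dl (dupL (List.ofFn b) ++ l) p) := by
  induction j generalizing p with
  | zero => simp [dupL]
  | succ j ih =>
    rw [sum_fin_cons, Function.iterate_succ_apply, lapP, lapP_iter_sum, Dl_sum, coeff_sum]
    simp only [ih, List.ofFn_cons, dupL, List.cons_append, Dl]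

lemma gram_bound {I X A : Type} [Fintype I] [Fintype X] [Fintype A]
    (e : I → X) (he : Function.Injective e) (S : X → A → ℝ) :
    ∑ a, (∑ b, S (e b) a) ^ 2 ≤
      Fintype.card I * Real.sqrt (∑ q : X × X, (∑ a, S q.1 a * S q.2 a) ^ 2) := by
  have h1 : ∑ a, (∑ b, S (e b) a) ^ 2
      = ∑ q : I × I, ∑ a, S (e q.1) a * S (e q.2) a := by
    rw [Finset.sum_comm]
    refine Finset.sum_congr rfl fun a _ => ?_
    rw [sq, Finset.sum_mul_sum, Fintype.sum_prod_type]
  have h2 : (∑ q : I × I, ∑ a, S (e q.1) a * S (e q.2) a) ^ 2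
      ≤ (Fintype.card I : ℝ) ^ 2 * ∑ q : I × I, (∑ a, S (e q.1) a * S (e q.2) a) ^ 2 := by
    have := sq_sum_le_card_mul_sum_sq (s := (Finset.univ : Finset (I × I)))
      (f := fun q => ∑ a, S (e q.1) a * S (e q.2) a)
    simpa [sq, Fintype.card_prod] using this
  have h3 : ∑ q : I × I, (∑ a, S (e q.1) a * S (e q.2) a) ^ 2
      ≤ ∑ q : X × X, (∑ a, S q.1 a * S q.2 a) ^ 2 := by
    classical
    have := Finset.sum_map (Finset.univ : Finset (I × I))
      ((⟨e, he⟩ : I ↪ X).prodMap ⟨e, he⟩) (fun q : X × X => (∑ a, S q.1 a * S q.2 a) ^ 2)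
    refine le_trans (le_of_eq this.symm) ?_
    exact Finset.sum_le_sum_of_subset_of_nonneg (Finset.subset_univ _)
      fun _ _ _ => sq_nonneg _
  rw [h1]
  refine (Real.le_sqrt_of_sq_le h2).trans ?_
  rw [Real.sqrt_mul (by positivity), Real.sqrt_sq (by positivity)]
  gcongr

lemma splitIdx_ofFn (d k r : ℕ) (hr : r ≤ k) (x : Fin (k - r) → Fin d) (a : Fin r → Fin d) :
    List.ofFn (splitIdx d k r x a) = List.ofFn x ++ List.ofFn a := by
  apply List.ext_getElem
  · simp; omega
  · intro n h1 h2
    simp only [List.getElem_ofFn, List.getElem_append, List.length_ofFn, splitIdx]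

lemma derivSq_contr {d k j s : ℕ} (hjs : 2 * j + s = k) (β : MIdx d k → ℝ) :
    derivSq s (lapP^[j] (polyB β)) ≤ (Nat.factorial k : ℝ) ^ 2 *
      ((d : ℝ) ^ j * Real.sqrt (contrNormSq d k s (iotaT d k β) (iotaT d k β))) := by
  have hlen : ∀ b : Fin j → Fin d, (dupL (List.ofFn b)).length = k - s := fun b => by
    rw [dupL_length, List.length_ofFn]; omega
  let e : (Fin j → Fin d) → (Fin (k - s) → Fin d) := fun b t =>
    (dupL (List.ofFn b)).get (t.cast (hlen b).symm)
  have he1 : ∀ b, List.ofFn (e b) = dupL (List.ofFn b) := fun b => by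
    apply List.ext_getElem
    · simp [hlen]
    · intro n h1 h2
      simp [e]
  have he : Function.Injective e := fun b b' h => by
    have := congrArg List.ofFn h
    rw [he1, he1] at this
    exact List.ofFn_injective (dupL_inj _ _ this)
  have h1 : ∀ (a : Fin s → Fin d), coeff 0 (Dl (List.ofFn a) (lapP^[j] (polyB β)))
      = Nat.factorial k * ∑ b, iotaT d k β (splitIdx d k s (e b) a) := by
    intro a
    rw [Dl_lapP, Finset.mul_sum]
    refine Finset.sum_congr rfl fun b _ => ?_
    rw [← Dl_polyB, splitIdx_ofFn d k s (by omega), he1]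
  rw [derivSq_eq]
  simp only [h1, mul_pow]
  rw [← Finset.mul_sum]
  refine mul_le_mul_of_nonneg_left ?_ (by positivity)
  have := gram_bound e he (fun x a => iotaT d k β (splitIdx d k s x a))
  simpa [contrNormSq] using this

lemma Dl_pow {d : ℕ} (l : List (Fin d)) :
    Dl l ((∑ a, X a : MvPolynomial (Fin d) ℝ) ^ l.length) = C (Nat.factorial l.length : ℝ) := by
  have hC : ∀ (l : List (Fin d)) (a : ℝ) p, Dl l (C a * p) = C a * Dl l p := by
    intro l
    induction l with
    | nil => intros; rfl
    | cons i l ih => intro a p; rw [Dl, pderiv_C_mul, ih, Dl]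
  induction l with
  | nil => simp [Dl]
  | cons i l ih =>
    have : pderiv i (∑ a, X a : MvPolynomial (Fin d) ℝ) = 1 := by
      rw [map_sum, Finset.sum_eq_single i]
      · simp
      · intro b _ hb; exact pderiv_X_of_ne hb
      · simp
    rw [Dl, pderiv_pow, this, mul_one, List.length_cons, Nat.add_sub_cancel]
    have e : ((l.length + 1 : ℕ) : MvPolynomial (Fin d) ℝ) = C ((l.length + 1 : ℕ) : ℝ) := by simp
    rw [e, hC, ih, Nat.factorial_succ, ← C_mul]
    push_cast; rfl

lemma count_type {d k : ℕ} (κ : MIdx d k) :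
    ((Finset.univ.filter fun i : Fin k → Fin d => typeOf i = κ.1).card : ℝ) *
      ∏ a, (Nat.factorial (κ.1 a) : ℝ) ≤ Nat.factorial k := by
  rcases Finset.eq_empty_or_nonempty
    (Finset.univ.filter fun i : Fin k → Fin d => typeOf i = κ.1) with h | ⟨i, hi⟩
  · rw [h]; simp
  · have hi : typeOf i = κ.1 := (Finset.mem_filter.1 hi).2
    have h1 := Dl_coeff (List.ofFn i) ((∑ a, X a : MvPolynomial (Fin d) ℝ) ^ k)
    have h2 := Dl_pow (List.ofFn i)
    rw [List.length_ofFn] at h2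
    rw [h2, cntL_ofFn, hi] at h1
    simp only [Finsupp.equivFunOnFinite_symm_apply_apply, coeff_C, if_true] at h1
    rw [h1]
    refine le_of_eq ?_
    congr 1
    rw [Fintype.sum_pow, coeff_sum, Finset.card_filter]
    push_cast
    refine Finset.sum_congr rfl fun f _ => ?_
    have h3 : ∏ t, (X (f t) : MvPolynomial (Fin d) ℝ)
        = monomial (Finsupp.equivFunOnFinite.symm (typeOf f)) 1 := by
      have : ∀ t, (X (f t) : MvPolynomial (Fin d) ℝ) = monomial (Finsupp.single (f t) 1) 1 :=
        fun t => rfl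
      simp only [this]
      rw [← monomial_sum_one]
      have h4 : ∑ t, Finsupp.single (f t) 1 = Finsupp.equivFunOnFinite.symm (typeOf f) := by
        ext a
        simp [typeOf, Finsupp.finsetSum_apply, Finsupp.single_apply]
      rw [h4]
    rw [h3, coeff_monomial]
    simp

lemma iotaT_norm {d k : ℕ} (β : MIdx d k → ℝ) :
    ∑ i, iotaT d k β i ^ 2 ≤ ∑ κ, β κ ^ 2 := by
  have h1 : ∀ i : Fin k → Fin d, iotaT d k β i ^ 2 =
      ((∏ a, (Nat.factorial (typeOf i a) : ℝ)) / (Nat.factorial k : ℝ)) *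
        β ⟨typeOf i, typeOf_mem i⟩ ^ 2 := by
    intro i
    rw [iotaT, dif_pos (typeOf_mem i), mul_pow, Real.sq_sqrt (by positivity)]
  simp only [h1]
  rw [← Finset.sum_fiberwise (s := Finset.univ)
    (g := fun i : Fin k → Fin d => (⟨typeOf i, typeOf_mem i⟩ : MIdx d k))]
  refine Finset.sum_le_sum fun κ _ => ?_
  have h2 : ∀ i ∈ Finset.univ.filter
      (fun i : Fin k → Fin d => (⟨typeOf i, typeOf_mem i⟩ : MIdx d k) = κ),
      ((∏ a, (Nat.factorial (typeOf i a) : ℝ)) / (Nat.factorial k : ℝ)) *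
        β ⟨typeOf i, typeOf_mem i⟩ ^ 2
      = ((∏ a, (Nat.factorial (κ.1 a) : ℝ)) / (Nat.factorial k : ℝ)) * β κ ^ 2 := by
    intro i hi
    have := (Finset.mem_filter.1 hi).2
    subst this
    rfl
  rw [Finset.sum_congr rfl h2, Finset.sum_const, nsmul_eq_mul]
  have h3 := count_type κ
  have h4 : (Finset.univ.filter
      (fun i : Fin k → Fin d => (⟨typeOf i, typeOf_mem i⟩ : MIdx d k) = κ))
      = Finset.univ.filter fun i : Fin k → Fin d => typeOf i = κ.1 := by
    ext i; simp [Subtype.ext_iff]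
  rw [h4, ← mul_assoc, ← mul_div_assoc]
  refine mul_le_of_le_one_left (sq_nonneg _) ?_
  exact (div_le_one (by positivity)).2 h3

lemma derivSq_zero_case {d k : ℕ} (β : MIdx d k → ℝ) (hβ : enorm2 β = 1) :
    derivSq k (polyB β) ≤ (Nat.factorial k : ℝ) ^ 2 := by
  have h := iotaT_norm β
  have h1 : ∑ κ, β κ ^ 2 = 1 := by
    unfold enorm2 at hβ
    exact (Real.sqrt_eq_one).1 hβ
  rw [derivSq_eq]
  simp only [Dl_polyB, mul_pow]
  rw [← Finset.mul_sum]
  refine mul_le_of_le_one_right (by positivity) ?_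
  linarith

lemma derivSq_lap_zero {d : ℕ} (q : MvPolynomial (Fin d) ℝ) :
    derivSq 0 (lapP q) ≤ d * derivSq 2 q := by
  simp only [derivSq, lapP, coeff_sum]
  have := sq_sum_le_card_mul_sum_sq (s := (Finset.univ : Finset (Fin d)))
    (f := fun i => coeff 0 (pderiv i (pderiv i q)))
  refine this.trans ?_
  simp only [Finset.card_univ, Fintype.card_fin]
  refine mul_le_mul_of_nonneg_left ?_ (by positivity)
  refine Finset.sum_le_sum fun i _ => ?_
  exact Finset.single_le_sum (f := fun j => coeff 0 (pderiv j (pderiv i q)) ^ 2)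
    (fun _ _ => sq_nonneg _) (Finset.mem_univ i)

lemma derivSq_all {d k : ℕ} (hd : 1 ≤ d) (hk : 3 ≤ k) (c : ℝ) (β : MIdx d k → ℝ)
    (hβ : enorm2 β = 1)
    (hcon : ∀ r : ℕ, 1 ≤ r → r ≤ k - 1 →
      Real.sqrt (contrNormSq d k r (iotaT d k β) (iotaT d k β)) ≤ (d : ℝ) ^ (-c))
    (j s : ℕ) (hjs : 2 * j + s = k) :
    derivSq s (lapP^[j] (polyB β)) ≤
      (Nat.factorial k : ℝ) ^ 2 * (d : ℝ) ^ ((k : ℝ) - 2 - min c 1) := by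
  have hd1 : (1 : ℝ) ≤ d := by exact_mod_cast hd
  have hd0 : (0 : ℝ) < d := by linarith
  have key : ∀ (m : ℕ), m + 2 ≤ k →
      (d : ℝ) ^ m * (d : ℝ) ^ (-c) ≤ (d : ℝ) ^ ((k : ℝ) - 2 - min c 1) := by
    intro m hm
    rw [← Real.rpow_natCast, ← Real.rpow_add hd0]
    refine Real.rpow_le_rpow_of_exponent_le hd1 ?_
    have : (m : ℝ) + 2 ≤ k := by exact_mod_cast hm
    have := min_le_left c 1
    linarith
  rcases Nat.eq_zero_or_pos j with rfl | hj
  · have hs : s = k := by omega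
    subst hs
    refine (derivSq_zero_case β hβ).trans ?_
    refine le_mul_of_one_le_right (by positivity) ?_
    refine Real.one_le_rpow hd1 ?_
    have : (3 : ℝ) ≤ s := by exact_mod_cast hk
    have := min_le_right c 1
    linarith
  · rcases Nat.eq_zero_or_pos s with rfl | hs
    · obtain ⟨j, rfl⟩ : ∃ j', j = j' + 1 := ⟨j - 1, by omega⟩
      rw [Function.iterate_succ_apply']
      refine (derivSq_lap_zero _).trans ?_
      have h1 := derivSq_contr (d := d) (k := k) (j := j) (s := 2) (by omega) β
      have h2 := hcon 2 (by omega) (by omega)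
      calc (d : ℝ) * derivSq 2 (lapP^[j] (polyB β))
          ≤ d * ((Nat.factorial k : ℝ) ^ 2 * ((d : ℝ) ^ j * (d : ℝ) ^ (-c))) := by
            refine mul_le_mul_of_nonneg_left (h1.trans ?_) hd0.le
            gcongr
        _ = (Nat.factorial k : ℝ) ^ 2 * ((d : ℝ) ^ (j + 1) * (d : ℝ) ^ (-c)) := by ring
        _ ≤ _ := by
            refine mul_le_mul_of_nonneg_left (key _ (by omega)) (by positivity)
    · refine (derivSq_contr hjs β).trans ?_
      refine mul_le_mul_of_nonneg_left ?_ (by positivity)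
      refine le_trans ?_ (key j (by omega))
      exact mul_le_mul_of_nonneg_left (hcon s hs (by omega)) (by positivity)

end TensorPart
section ConcentrationPart
open MvPolynomial Filter Topology

lemma gauss_exp_integral :
    ∫ x, Real.exp (-(x ^ 2) / 2) ∂(gaussianReal 0 1) = (Real.sqrt 2)⁻¹ := by
  rw [integral_gaussianReal_eq_integral_smul one_ne_zero]
  have h : ∀ x : ℝ, gaussianPDFReal 0 1 x • Real.exp (-(x ^ 2) / 2)
      = (Real.sqrt (2 * Real.pi))⁻¹ * Real.exp (-1 * x ^ 2) := by
    intro x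
    simp only [gaussianPDFReal, smul_eq_mul, NNReal.coe_one, mul_one, sub_zero]
    rw [mul_assoc, ← Real.exp_add]
    congr 2
    ring
  simp only [h]
  rw [integral_const_mul, integral_gaussian, div_one, Real.sqrt_mul (by norm_num)]
  have : Real.sqrt Real.pi ≠ 0 := (Real.sqrt_pos.2 Real.pi_pos).ne'
  field_simp

lemma gauss_exp_integrable :
    Integrable (fun x : ℝ => Real.exp (-(x ^ 2) / 2)) (gaussianReal 0 1) := by
  refine Integrable.of_integral_ne_zero ?_
  rw [gauss_exp_integral]
  positivity

lemma small_ball (d : ℕ) :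
    (stdG (Fin d)).real {x | ∑ i, x i ^ 2 ≤ (d : ℝ) / 2}
      ≤ (Real.exp (1 / 4) / Real.sqrt 2) ^ d := by
  have hint : Integrable (fun x : Fin d → ℝ => ∏ i, Real.exp (-(x i ^ 2) / 2))
      (stdG (Fin d)) :=
    Integrable.fintype_prod (f := fun (_ : Fin d) (y : ℝ) => Real.exp (-(y ^ 2) / 2))
      fun _ => gauss_exp_integrable
  have hval : ∫ x : Fin d → ℝ, ∏ i, Real.exp (-(x i ^ 2) / 2) ∂(stdG (Fin d))
      = ((Real.sqrt 2)⁻¹) ^ d := by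
    unfold stdG
    rw [integral_fintype_prod_eq_prod
      (f := fun (_ : Fin d) (y : ℝ) => Real.exp (-(y ^ 2) / 2))]
    simp [gauss_exp_integral]
  have hm := mul_meas_ge_le_integral_of_nonneg
    (ae_of_all _ fun x => Finset.prod_nonneg fun i _ => (Real.exp_pos _).le) hint
    (Real.exp (-(1 / 4)) ^ d)
  rw [hval] at hm
  have hs : {x : Fin d → ℝ | ∑ i, x i ^ 2 ≤ (d : ℝ) / 2} ⊆
      {x | Real.exp (-(1 / 4)) ^ d ≤ ∏ i, Real.exp (-(x i ^ 2) / 2)} := by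
    intro x hx
    simp only [Set.mem_ofPred_eq] at hx ⊢
    rw [← Real.exp_sum, ← Real.exp_nat_mul, Real.exp_le_exp, ← Finset.sum_div,
      Finset.sum_neg_distrib]
    linarith
  have h1 := measureReal_mono (μ := stdG (Fin d)) hs
  refine h1.trans ?_
  rw [div_eq_mul_inv (Real.exp (1 / 4)) (Real.sqrt 2), mul_pow]
  have e : Real.exp (1 / 4) ^ d * Real.exp (-(1 / 4)) ^ d = 1 := by
    rw [← mul_pow, ← Real.exp_add]; simp
  calc _ = Real.exp (1 / 4) ^ d * (Real.exp (-(1 / 4)) ^ d *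
        (stdG (Fin d)).real {x | Real.exp (-(1 / 4)) ^ d ≤ ∏ i, Real.exp (-(x i ^ 2) / 2)}) := by
        rw [← mul_assoc, e, one_mul]
    _ ≤ _ := by gcongr

lemma rho_lt : Real.exp (1 / 4) / Real.sqrt 2 < 1 := by
  rw [div_lt_one (by positivity)]
  apply Real.lt_sqrt_of_sq_lt
  rw [← Real.exp_nat_mul]
  have h : Real.exp ((2 : ℕ) * (1 / 4)) ^ 2 < 2 ^ 2 := by
    rw [← Real.exp_nat_mul]
    have := Real.exp_one_lt_d9
    norm_num at this ⊢
    linarith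
  exact lt_of_pow_lt_pow_left₀ 2 (by norm_num) h

lemma tail_bound {d n : ℕ} (F : MvPolynomial (Fin d) ℝ) (M τ : ℝ) (hτ : 0 < τ)
    (h : gE ((F ^ 2) ^ (n + 1)) ≤ M) :
    (stdG (Fin d)).real {x | τ ≤ (eval x F) ^ 2} ≤ M / τ ^ (n + 1) := by
  have hm := mul_meas_ge_le_integral_of_nonneg (μ := stdG (Fin d))
    (f := fun x => eval x ((F ^ 2) ^ (n + 1)))
    (ae_of_all _ fun x => by simp only [map_pow, Pi.zero_apply]; positivity)
    (poly_integrable _) (τ ^ (n + 1))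
  rw [le_div_iff₀ (by positivity), mul_comm]
  refine le_trans ?_ (hm.trans h)
  refine mul_le_mul_of_nonneg_left (measureReal_mono ?_) (by positivity)
  intro x hx
  simp only [Set.mem_ofPred_eq, map_pow] at hx ⊢
  gcongr

lemma qvec_smul {d k : ℕ} (a : ℝ) (x : Fin d → ℝ) (β : MIdx d k → ℝ) :
    dotp (qvec d k (a • x)) β = a ^ k * dotp (qvec d k x) β := by
  simp only [dotp, Finset.mul_sum]
  refine Finset.sum_congr rfl fun κ _ => ?_
  have : ∏ i, (a • x) i ^ κ.1 i = a ^ k * ∏ i, x i ^ κ.1 i := by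
    simp only [Pi.smul_apply, smul_eq_mul, mul_pow, Finset.prod_mul_distrib]
    rw [Finset.prod_pow_eq_pow_sum, Finset.Nat.mem_antidiagonalTuple.1 κ.2]
  simp only [qvec, this]
  ring

lemma meas_normalize (d : ℕ) :
    Measurable fun x : Fin d → ℝ => (enorm2 x)⁻¹ • x := by
  unfold enorm2
  fun_prop

lemma meas_bad {d k : ℕ} (t : ℝ) (β : MIdx d k → ℝ) :
    MeasurableSet {w : Fin d → ℝ | t < |dotp (qvec d k w) β|} := by
  refine measurableSet_lt measurable_const ?_
  unfold dotp qvec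
  fun_prop

instance unifSphere_prob (d : ℕ) : IsProbabilityMeasure (unifSphere (Fin d)) :=
  Measure.isProbabilityMeasure_map (meas_normalize d).aemeasurable

lemma sphere_tail {d k n : ℕ} (hd : 1 ≤ d) (β : MIdx d k → ℝ) (M t : ℝ) (ht : 0 < t)
    (h : gE ((polyB β ^ 2) ^ (n + 1)) ≤ M) :
    (unifSphere (Fin d)).real {w | t < |dotp (qvec d k w) β|} ≤
      (Real.exp (1 / 4) / Real.sqrt 2) ^ d + M / (t ^ 2 * ((d : ℝ) / 2) ^ k) ^ (n + 1) := by
  have hd0 : (0 : ℝ) < d := by exact_mod_cast hd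
  unfold unifSphere
  rw [measureReal_def, Measure.map_apply (meas_normalize d) (meas_bad t β), ← measureReal_def]
  have hsub : (fun x : Fin d → ℝ => (enorm2 x)⁻¹ • x) ⁻¹' {w | t < |dotp (qvec d k w) β|} ⊆
      {x | ∑ i, x i ^ 2 ≤ (d : ℝ) / 2} ∪
      {x | t ^ 2 * ((d : ℝ) / 2) ^ k ≤ (eval x (polyB β)) ^ 2} := by
    intro x hx
    by_cases hx2 : ∑ i, x i ^ 2 ≤ (d : ℝ) / 2
    · exact Or.inl hx2
    · right
      push Not at hx2
      simp only [Set.mem_preimage, Set.mem_ofPred_eq, qvec_smul] at hx ⊢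
      rw [eval_polyB]
      have hS : 0 < ∑ i, x i ^ 2 := lt_trans (by positivity) hx2
      have hN : 0 < enorm2 x := Real.sqrt_pos.2 hS
      have hN2 : enorm2 x ^ 2 = ∑ i, x i ^ 2 := Real.sq_sqrt hS.le
      rw [abs_mul, abs_of_pos (by positivity), inv_pow, inv_mul_eq_div,
        lt_div_iff₀ (by positivity)] at hx
      rw [← sq_abs (dotp _ _)]
      calc t ^ 2 * ((d : ℝ) / 2) ^ k ≤ t ^ 2 * (enorm2 x ^ 2) ^ k := by
            rw [hN2]; gcongr
        _ = (t * enorm2 x ^ k) ^ 2 := by ring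
        _ ≤ _ := by gcongr
  refine (measureReal_mono hsub).trans ((measureReal_union_le _ _).trans ?_)
  exact add_le_add (small_ball d) (tail_bound _ M _ (by positivity) h)

lemma union_bound {d k p : ℕ} (β : MIdx d k → ℝ) (t δ ε : ℝ)
    (h : (unifSphere (Fin d)).real {w | t < |dotp (qvec d k w) β|} ≤ δ) (hε : p * δ ≤ ε)
    (S : Set (Fin p → Fin d → ℝ))
    (hS : ∀ w : Fin p → Fin d → ℝ, (∀ j, |dotp (qvec d k (w j)) β| ≤ t) → w ∈ S) :
    1 - ENNReal.ofReal ε ≤ (Measure.pi fun _ : Fin p => unifSphere (Fin d)) S := by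
  set μ := Measure.pi fun _ : Fin p => unifSphere (Fin d) with hμ
  set Bad : Set (Fin d → ℝ) := {w | t < |dotp (qvec d k w) β|} with hBad
  have hδ : 0 ≤ δ := le_trans measureReal_nonneg h
  have hmB : ∀ j : Fin p, MeasurableSet {w : Fin p → Fin d → ℝ | w j ∈ Bad} := fun j =>
    (measurable_pi_apply j) (meas_bad t β)
  have hmU : MeasurableSet (⋃ j : Fin p, {w : Fin p → Fin d → ℝ | w j ∈ Bad}) :=
    MeasurableSet.iUnion hmB
  have h1 : μ (⋃ j : Fin p, {w : Fin p → Fin d → ℝ | w j ∈ Bad}) ≤ ENNReal.ofReal ε := by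
    refine (measure_iUnion_fintype_le _ _).trans ?_
    have h2 : ∀ j : Fin p, μ {w : Fin p → Fin d → ℝ | w j ∈ Bad} ≤ ENNReal.ofReal δ := by
      intro j
      have := (measurePreserving_eval (fun _ : Fin p => unifSphere (Fin d)) j).measure_preimage
        (meas_bad t β).nullMeasurableSet
      refine le_trans (le_of_eq this) ?_
      rw [← ofReal_measureReal]
      exact ENNReal.ofReal_le_ofReal h
    refine (Finset.sum_le_sum fun j _ => h2 j).trans ?_
    rw [Finset.sum_const, Finset.card_univ, Fintype.card_fin, nsmul_eq_mul,
      ← ENNReal.ofReal_natCast, ← ENNReal.ofReal_mul (by positivity)]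
    exact ENNReal.ofReal_le_ofReal hε
  have h3 : (⋃ j : Fin p, {w : Fin p → Fin d → ℝ | w j ∈ Bad})ᶜ ⊆ S := by
    intro w hw
    apply hS
    intro j
    by_contra hc
    exact hw (Set.mem_iUnion.2 ⟨j, not_le.1 hc⟩)
  refine le_trans ?_ (measure_mono h3)
  rw [prob_compl_eq_one_sub hmU]
  exact tsub_le_tsub_left h1 1

end ConcentrationPart

lemma rho_eventually (ρ : ℝ) (h0 : 0 ≤ ρ) (h1 : ρ < 1) (C C0 A : ℝ) (hC0 : 0 < C0) :
    ∃ d₀ : ℕ, ∀ d : ℕ, d₀ ≤ d → 1 ≤ d →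
      C0 * (d:ℝ)^2 * (ρ^d + A * (d:ℝ)^(-(C+3))) ≤ (d:ℝ)^(-C) := by
  obtain ⟨N, hN⟩ := exists_nat_ge (C + 2)
  have h2 : Filter.Tendsto (fun d : ℕ => (d:ℝ)^N * ρ^d) Filter.atTop (nhds 0) :=
    tendsto_pow_const_mul_const_pow_of_abs_lt_one N (by rw [abs_of_nonneg h0]; exact h1)
  have h3 : Filter.Tendsto (fun d : ℕ => C0 * ((d:ℝ)^N * ρ^d) + C0 * A / (d:ℝ))
      Filter.atTop (nhds (C0 * 0 + 0)) :=
    (h2.const_mul C0).add (tendsto_const_div_atTop_nhds_zero_nat _)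
  have h4 : ∀ᶠ d : ℕ in Filter.atTop, C0 * ((d:ℝ)^N * ρ^d) + C0 * A / (d:ℝ) < 1 :=
    h3.eventually (gt_mem_nhds (by norm_num))
  obtain ⟨d₀, hd₀⟩ := Filter.eventually_atTop.1 h4
  refine ⟨d₀, fun d hd hd1 => ?_⟩
  have h5 := hd₀ d hd
  have hdp : (0:ℝ) < d := by exact_mod_cast hd1
  have hd1' : (1:ℝ) ≤ d := by exact_mod_cast hd1
  have e1 : (d:ℝ)^2 = (d:ℝ)^(-C) * (d:ℝ)^(C+2) := by
    rw [← Real.rpow_add hdp, ← Real.rpow_natCast]; congr 1; push_cast; ring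
  have e2 : (d:ℝ)^2 * (d:ℝ)^(-(C+3)) = (d:ℝ)^(-C) * (d:ℝ)⁻¹ := by
    rw [← Real.rpow_neg_one, ← Real.rpow_add hdp, ← Real.rpow_natCast, ← Real.rpow_add hdp]
    congr 1; push_cast; ring
  have e3 : (d:ℝ)^(C+2) ≤ (d:ℝ)^N := by
    rw [← Real.rpow_natCast]; exact Real.rpow_le_rpow_of_exponent_le hd1' hN
  have hpos : 0 < (d:ℝ)^(-C) := Real.rpow_pos_of_pos hdp _
  calc C0 * (d:ℝ)^2 * (ρ^d + A * (d:ℝ)^(-(C+3)))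
      = C0 * (d:ℝ)^2 * ρ^d + C0 * A * ((d:ℝ)^2 * (d:ℝ)^(-(C+3))) := by ring
    _ = (d:ℝ)^(-C) * (C0 * ((d:ℝ)^(C+2) * ρ^d) + C0 * A / (d:ℝ)) := by
        rw [e2, e1]; ring
    _ ≤ (d:ℝ)^(-C) * (C0 * ((d:ℝ)^N * ρ^d) + C0 * A / (d:ℝ)) := by gcongr
    _ ≤ (d:ℝ)^(-C) * 1 := by gcongr
    _ = _ := mul_one _

lemma ratio_bound (d k n : ℕ) (hd : 1 ≤ d) (K c1 C : ℝ) (hK : 0 ≤ K)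
    (hn : C + 3 ≤ (n+1 : ℝ) * (c1/2)) :
    K * ((k.factorial : ℝ)^2 * (d:ℝ)^((k:ℝ) - 2 - c1))^(n+1)
      / (((d:ℝ)^(-1 - c1/4))^2 * ((d:ℝ)/2)^k)^(n+1)
      ≤ (K * ((k.factorial : ℝ)^2 * 2^k)^(n+1)) * (d:ℝ)^(-(C+3)) := by
  have hdp : (0:ℝ) < d := by exact_mod_cast hd
  have hd1' : (1:ℝ) ≤ d := by exact_mod_cast hd
  have e1 : ((d:ℝ)^(-1 - c1/4))^2 = (d:ℝ)^(-2 - c1/2) := by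
    rw [← Real.rpow_natCast, ← Real.rpow_mul hdp.le]; congr 1; push_cast; ring
  have e2 : (d:ℝ)^((k:ℝ) - 2 - c1) = (d:ℝ)^(-(c1/2)) * ((d:ℝ)^(-2 - c1/2) * (d:ℝ)^k) := by
    rw [← Real.rpow_natCast, ← Real.rpow_add hdp, ← Real.rpow_add hdp]; congr 1; ring
  have hp1 : 0 < (d:ℝ)^(-2 - c1/2) := Real.rpow_pos_of_pos hdp _
  have hp2 : 0 < (d:ℝ)^k := pow_pos hdp _
  have e3 : (k.factorial : ℝ)^2 * (d:ℝ)^((k:ℝ) - 2 - c1)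
      = ((k.factorial : ℝ)^2 * 2^k * (d:ℝ)^(-(c1/2))) *
        (((d:ℝ)^(-1 - c1/4))^2 * ((d:ℝ)/2)^k) := by
    rw [e1, e2, div_pow]; field_simp
  have hτ : 0 < ((d:ℝ)^(-1 - c1/4))^2 * ((d:ℝ)/2)^k := by positivity
  rw [e3, mul_pow _ (((d:ℝ)^(-1 - c1/4))^2 * ((d:ℝ)/2)^k), ← mul_assoc,
    mul_div_assoc, div_self (pow_pos hτ _).ne', mul_one, mul_pow _ ((d:ℝ)^(-(c1/2))), ← mul_assoc]
  gcongr
  rw [← Real.rpow_natCast, ← Real.rpow_mul hdp.le]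
  apply Real.rpow_le_rpow_of_exponent_le hd1'
  push_cast
  linarith

lemma event_incl (d p : ℕ) (c1 C0 : ℝ) (hd : 1 ≤ d) (hp : (p:ℝ) ≤ C0 * (d:ℝ)^2)
    (hl1 : 1 ≤ Real.log d) (hl2 : C0 ≤ Real.log d) (v : Fin p → ℝ)
    (hv : ∀ j, |v j| ≤ (d:ℝ)^(-1 - c1/4)) :
    enorm2 v ≤ Real.log d ^ (1:ℝ) * (d:ℝ)^(-(c1/4)) ∧
      ∀ K : ℝ, 0 < K → ∀ θ : Fin p → ℝ, enorm2 θ ≤ Real.log d ^ K →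
        |∑ j, θ j * v j| ≤ Real.log d ^ (K + 1) * (d:ℝ)^(-(c1/4)) := by
  have hdp : (0:ℝ) < d := by exact_mod_cast hd
  have hlp : 0 < Real.log d := by linarith
  have e1 : (d:ℝ)^2 * ((d:ℝ)^(-1 - c1/4))^2 = ((d:ℝ)^(-(c1/4)))^2 := by
    rw [← mul_pow]; congr 1
    nth_rewrite 1 [← Real.rpow_one (d:ℝ)]
    rw [← Real.rpow_add hdp]; congr 1; ring
  have hq : 0 < (d:ℝ)^(-(c1/4)) := Real.rpow_pos_of_pos hdp _
  have h1 : enorm2 v ≤ Real.log d ^ (1:ℝ) * (d:ℝ)^(-(c1/4)) := by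
    rw [Real.rpow_one]
    apply Real.sqrt_le_iff.2 ⟨by positivity, ?_⟩
    calc ∑ j, (v j)^2 ≤ ∑ _j : Fin p, ((d:ℝ)^(-1 - c1/4))^2 := by
          apply Finset.sum_le_sum; intro j _
          rw [← sq_abs]; exact pow_le_pow_left₀ (abs_nonneg _) (hv j) 2
      _ = (p:ℝ) * ((d:ℝ)^(-1 - c1/4))^2 := by simp
      _ ≤ (C0 * (d:ℝ)^2) * ((d:ℝ)^(-1 - c1/4))^2 := by gcongr
      _ = C0 * ((d:ℝ)^(-(c1/4)))^2 := by rw [mul_assoc, e1]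
      _ ≤ (Real.log d)^2 * ((d:ℝ)^(-(c1/4)))^2 := by
          gcongr; nlinarith
      _ = _ := by ring
  refine ⟨h1, fun K _ θ hθ => ?_⟩
  have hcs : |∑ j, θ j * v j| ≤ enorm2 θ * enorm2 v := by
    apply Real.abs_le_sqrt (Finset.sum_mul_sq_le_sq_mul_sq Finset.univ θ v) |>.trans
    rw [Real.sqrt_mul (Finset.sum_nonneg fun _ _ => sq_nonneg _)]
    exact le_refl _
  calc _ ≤ enorm2 θ * enorm2 v := hcs
    _ ≤ Real.log d ^ K * (Real.log d ^ (1:ℝ) * (d:ℝ)^(-(c1/4))) :=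
        mul_le_mul hθ h1 (Real.sqrt_nonneg _) (Real.rpow_nonneg hlp.le _)
    _ = _ := by rw [Real.rpow_add hlp, mul_assoc]

/-- **Lemma B.12**: for a generic unit direction `β` (vanishing contractions) and
i.i.d. spherical weights `w₁,…,w_p`, the projection `V_k β` is small with high
probability, uniformly against bounded test vectors `θ`. -/
theorem generic_projection_of_higher_features (k : ℕ) (hk : 3 ≤ k) (c C0 : ℝ)
    (hc : 0 < c) (hC0 : 0 < C0) :
    ∃ c' : ℝ, 0 < c' ∧
      ∀ C : ℝ, 0 < C →
        ∃ K' : ℝ, 0 < K' ∧ ∃ d₀ : ℕ, 0 < d₀ ∧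
          ∀ d : ℕ, d₀ ≤ d → ∀ p : ℕ, 1 ≤ p → (p : ℝ) ≤ C0 * (d : ℝ) ^ 2 →
          ∀ β : MIdx d k → ℝ, enorm2 β = 1 →
          (∀ r : ℕ, 1 ≤ r → r ≤ k - 1 →
            Real.sqrt (contrNormSq d k r (iotaT d k β) (iotaT d k β)) ≤ (d : ℝ) ^ (-c)) →
          1 - ENNReal.ofReal ((d : ℝ) ^ (-C)) ≤
            (Measure.pi fun _ : Fin p => unifSphere (Fin d))
              {w | enorm2 (fun j => dotp (qvec d k (w j)) β) ≤
                    Real.log d ^ K' * (d : ℝ) ^ (-c') ∧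
                  ∀ K : ℝ, 0 < K → ∀ θ : Fin p → ℝ, enorm2 θ ≤ Real.log d ^ K →
                    |∑ j, θ j * dotp (qvec d k (w j)) β| ≤
                      Real.log d ^ (K + K') * (d : ℝ) ^ (-c')} := by
  set c1 := min c 1 with hc1
  have hc1p : 0 < c1 := lt_min hc one_pos
  refine ⟨c1/4, by positivity, fun C hC => ?_⟩
  obtain ⟨n, hn⟩ := exists_nat_ge ((C+3) / (c1/2))
  have hn' : C + 3 ≤ (n+1 : ℝ) * (c1/2) := by
    rw [div_le_iff₀ (by positivity)] at hn
    nlinarith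
  obtain ⟨K, hK0, hK⟩ := moment_bound n k
  obtain ⟨d1, hd1⟩ := rho_eventually (Real.exp (1/4) / Real.sqrt 2) (by positivity) rho_lt C C0
    (K * ((k.factorial : ℝ)^2 * 2^k)^(n+1)) hC0
  obtain ⟨d2, hd2⟩ := Filter.eventually_atTop.1
    ((Real.tendsto_log_atTop.comp tendsto_natCast_atTop_atTop).eventually_ge_atTop (max 1 C0))
  refine ⟨1, one_pos, d1 + d2 + 1, by omega, fun d hd p hp1 hp β hβ hcon => ?_⟩
  have hdd : 1 ≤ d := by omega
  have hdp : (0:ℝ) < d := by exact_mod_cast hdd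
  have hlog : max 1 C0 ≤ Real.log d := hd2 d (by omega)
  have hm : gE ((polyB β ^ 2)^(n+1)) ≤
      K * ((k.factorial : ℝ)^2 * (d:ℝ)^((k:ℝ) - 2 - c1))^(n+1) := by
    have := hK d Unit (fun _ => polyB β) ((k.factorial : ℝ)^2 * (d:ℝ)^((k:ℝ) - 2 - c1))
      (fun _ => polyB_hom β) (fun j s hjs => by
        simpa using derivSq_all hdd hk c β hβ hcon j s hjs)
    simpa using this
  have hst := sphere_tail hdd β _ ((d:ℝ)^(-1 - c1/4)) (Real.rpow_pos_of_pos hdp _) hm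
  have hrat := ratio_bound d k n hdd K c1 C hK0 hn'
  refine union_bound β ((d:ℝ)^(-1 - c1/4)) _ ((d:ℝ)^(-C)) (hst.trans (add_le_add le_rfl hrat)) ?_ _ ?_
  · refine le_trans ?_ (hd1 d (by omega) hdd)
    apply mul_le_mul_of_nonneg_right hp
    positivity
  · intro w hw
    exact event_incl d p c1 C0 hdd hp ((le_max_left _ _).trans hlog)
      ((le_max_right _ _).trans hlog) (fun j => dotp (qvec d k (w j)) β) hw
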